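/- There exists a constant c > 0 such that the following holds for all sufficiently large n: if n^{1/10} ≤ k ≤ n^{9/10} and the sequence of positive integers (n_1, n_2, …, n_r) is (n, k)-strong, then ∑_{i=1}^r n_i² ≥ c · (n²/k) · log n. -/

import Mathlib

/-- `E` has a bipartite independent set of size `k × k`: a pair of subsets
`S ⊆ V`, `T ⊆ W` of size `k` each with no edge between them. -/
def HasBipIndepSet (n k : ℕ) (E : Finset (Fin n × Fin n)) : Prop :=
  ∃ S T : Finset (Fin n), S.card = k ∧ T.card = k ∧ ∀ s ∈ S, ∀ t ∈ T, (s, t) ∉ E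

/-- The sequence `(ns 0, …, ns (r-1))` is `(n, k)`-strong: there is a bipartite
graph `G = (V, W, E)` with `|V| = |W| = n` that is the union of complete bipartite
graphs `G_i = (V_i, W_i, V_i × W_i)` with `|V_i| = |W_i| = ns i`, and `G` has no
bipartite independent set of size `k × k`. -/
def IsStrong (n k r : ℕ) (ns : Fin r → ℕ) : Prop :=
  ∃ V W : Fin r → Finset (Fin n),
    (∀ i, (V i).card = ns i) ∧ (∀ i, (W i).card = ns i) ∧
    ¬ HasBipIndepSet n k
      ((Finset.univ : Finset (Fin n × Fin n)).filter
        (fun p => ∃ i, p.1 ∈ V i ∧ p.2 ∈ W i))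

open Finset in
/-- If every vertex of `A` has degree at most `d`, then choosing right vertices greedily gives a
set `T` of size `j` whose common non-neighbourhood in `A` is large. -/
theorem exists_large_common_nonneighborhood {n : ℕ} (E : Finset (Fin n × Fin n))
    (A : Finset (Fin n)) (d : ℝ) (hd : ∀ s ∈ A, (#{t | (s, t) ∈ E} : ℝ) ≤ d)
    (hq : 0 ≤ 1 - 2 * d / n) (j : ℕ) (hj : 2 * j ≤ n) :
    ∃ S T : Finset (Fin n), S ⊆ A ∧ #T = j ∧ (∀ s ∈ S, ∀ t ∈ T, (s, t) ∉ E) ∧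
      (#A : ℝ) * (1 - 2 * d / n) ^ j ≤ #S := by
  induction j with
  | zero => exact ⟨A, ∅, Subset.rfl, by simp, by simp, by simp⟩
  | succ j ih =>
    obtain ⟨S, T, hSA, hT, hST, hS⟩ := ih (by omega)
    have hn : (0 : ℝ) < n := by exact_mod_cast (by omega : 0 < n)
    have hTc : (n : ℝ) / 2 ≤ #Tᶜ := by
      have h : n ≤ 2 * #Tᶜ := by rw [card_compl, Fintype.card_fin]; omega
      have : (n : ℝ) ≤ 2 * #Tᶜ := by exact_mod_cast h
      linarith
    have hne : (Tᶜ).Nonempty := by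
      rw [nonempty_iff_ne_empty]
      rintro h
      rw [h, card_empty, Nat.cast_zero] at hTc
      linarith
    obtain ⟨t, ht, hcard⟩ : ∃ t ∈ Tᶜ, (#{s ∈ S | (s, t) ∈ E} : ℝ) ≤ #S * (2 * d / n) := by
      apply exists_le_of_sum_le hne
      have hcomm : ∑ t ∈ Tᶜ, #{s ∈ S | (s, t) ∈ E} = ∑ s ∈ S, #{t ∈ Tᶜ | (s, t) ∈ E} :=
        (sum_card_bipartiteAbove_eq_sum_card_bipartiteBelow (fun s t => (s, t) ∈ E)).symm
      calc ∑ t ∈ Tᶜ, (#{s ∈ S | (s, t) ∈ E} : ℝ)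
          = ∑ s ∈ S, (#{t ∈ Tᶜ | (s, t) ∈ E} : ℝ) := by exact_mod_cast hcomm
        _ ≤ ∑ s ∈ S, d := by
          refine sum_le_sum fun s hs => le_trans ?_ (hd s (hSA hs))
          exact_mod_cast card_le_card (filter_subset_filter _ (subset_univ _))
        _ = (n / 2) * (#S * (2 * d / n)) := by
          rw [sum_const, nsmul_eq_mul]
          field_simp
        _ ≤ #Tᶜ * (#S * (2 * d / n)) := by
          rcases S.eq_empty_or_nonempty with rfl | ⟨s, hs⟩
          · simp
          · have : 0 ≤ d := (Nat.cast_nonneg _).trans (hd s (hSA hs))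
            gcongr
        _ = ∑ t ∈ Tᶜ, (#S * (2 * d / n) : ℝ) := by rw [sum_const, nsmul_eq_mul]
    refine ⟨{s ∈ S | (s, t) ∉ E}, insert t T, (filter_subset _ _).trans hSA, ?_, ?_, ?_⟩
    · rw [card_insert_of_notMem (mem_compl.1 ht), hT]
    · intro s hs u hu
      rw [mem_filter] at hs
      rcases mem_insert.1 hu with rfl | hu
      · exact hs.2
      · exact hST s hs.1 u hu
    · have hsplit : (#{s ∈ S | (s, t) ∈ E} : ℝ) + #{s ∈ S | (s, t) ∉ E} = #S := by
        exact_mod_cast card_filter_add_card_filter_not (s := S) (fun s => (s, t) ∈ E)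
      rw [pow_succ, ← mul_assoc]
      have := mul_le_mul_of_nonneg_right hS hq
      linarith

open Finset in
/-- At least half of the left vertices have degree at most twice the average. -/
theorem half_le_card_low_degree {n : ℕ} (E : Finset (Fin n × Fin n)) (d : ℝ) (hd : 0 < d)
    (hE : (#E : ℝ) ≤ n * d / 2) :
    (n : ℝ) / 2 ≤ #{s : Fin n | (#{t | (s, t) ∈ E} : ℝ) ≤ d} := by
  have hsum : (#E : ℝ) = ∑ s : Fin n, (#{t | (s, t) ∈ E} : ℝ) := by
    rw [← Nat.cast_sum, Nat.cast_inj, ← card_sigma]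
    refine card_bij (fun p _ => ⟨p.1, p.2⟩) (by simp) ?_ ?_
    · rintro ⟨a, b⟩ _ ⟨a', b'⟩ _ h
      simpa using h
    · rintro ⟨a, b⟩ h
      exact ⟨(a, b), by simpa using h, rfl⟩
  have hsplit : (#{s : Fin n | (#{t | (s, t) ∈ E} : ℝ) ≤ d} : ℝ) +
      #{s : Fin n | ¬ (#{t | (s, t) ∈ E} : ℝ) ≤ d} = n := by
    have h := card_filter_add_card_filter_not (s := (univ : Finset (Fin n)))
      (fun s => (#{t | (s, t) ∈ E} : ℝ) ≤ d)
    rw [card_univ, Fintype.card_fin] at h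
    exact_mod_cast h
  have hhigh : (#{s : Fin n | ¬ (#{t | (s, t) ∈ E} : ℝ) ≤ d} : ℝ) * d ≤ #E := by
    rw [hsum, ← nsmul_eq_mul, ← sum_const]
    refine (sum_le_sum fun s hs => ?_).trans
      (sum_le_sum_of_subset_of_nonneg (filter_subset _ _) fun _ _ _ => Nat.cast_nonneg _)
    exact (not_le.1 (mem_filter.1 hs).2).le
  have : (#{s : Fin n | ¬ (#{t | (s, t) ∈ E} : ℝ) ≤ d} : ℝ) ≤ n / 2 :=
    le_of_mul_le_mul_right (by linarith) hd
  linarith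

theorem exp_neg_two_mul_le_one_sub {x : ℝ} (h0 : 0 ≤ x) (h1 : x ≤ 1 / 2) :
    Real.exp (-(2 * x)) ≤ 1 - x := by
  rw [Real.exp_neg, inv_le_comm₀ (Real.exp_pos _) (by linarith)]
  refine le_trans ?_ (Real.add_one_le_exp (2 * x))
  rw [inv_le_iff_one_le_mul₀ (by linarith)]
  nlinarith

open Finset in
/-- A union of complete bipartite graphs has at most `∑ |V i| * |W i|` edges. -/
theorem card_union_bicliques_le {n r : ℕ} (V W : Fin r → Finset (Fin n)) :
    #{p : Fin n × Fin n | ∃ i, p.1 ∈ V i ∧ p.2 ∈ W i} ≤ ∑ i, #(V i) * #(W i) := by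
  calc _ ≤ #(univ.biUnion fun i => V i ×ˢ W i) := by
        refine card_le_card fun p hp => ?_
        simpa using hp
    _ ≤ ∑ i, #(V i ×ˢ W i) := card_biUnion_le
    _ = ∑ i, #(V i) * #(W i) := by simp only [card_product]

open Finset in
/-- A bipartite graph with few edges has a `k × k` independent set. -/
theorem hasBipIndepSet_of_card_le {n k : ℕ} (hn : 2 ^ 50 ≤ n)
    (hk : (n : ℝ) ^ ((1 : ℝ) / 10) ≤ k) (hk' : (k : ℝ) ≤ (n : ℝ) ^ ((9 : ℝ) / 10))
    (E : Finset (Fin n × Fin n))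
    (hE : (#E : ℝ) ≤ 1 / 100 * ((n : ℝ) ^ 2 / k) * Real.log n) : HasBipIndepSet n k E := by
  have hnR : (2 : ℝ) ^ 50 ≤ n := by exact_mod_cast hn
  have hn1 : (1 : ℝ) < n := lt_of_lt_of_le (by norm_num) hnR
  have hn0 : (0 : ℝ) < n := by linarith
  have hk0 : (0 : ℝ) < k := lt_of_lt_of_le (by positivity) hk
  have hL : 0 < Real.log n := Real.log_pos hn1
  have h2 : (2 : ℝ) ≤ (n : ℝ) ^ ((1 : ℝ) / 50) := by
    calc (2 : ℝ) = ((2 : ℝ) ^ 50) ^ ((1 : ℝ) / 50) := by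
          rw [← Real.rpow_natCast, ← Real.rpow_mul (by norm_num)]
          norm_num
      _ ≤ _ := by gcongr
  have hkS : (k : ℝ) ≤ n / 2 * (n : ℝ) ^ (-(2 : ℝ) / 25) := by
    have h : (n : ℝ) * (n : ℝ) ^ (-(2 : ℝ) / 25) =
        (n : ℝ) ^ ((9 : ℝ) / 10) * (n : ℝ) ^ ((1 : ℝ) / 50) := by
      rw [← Real.rpow_add hn0]
      nth_rw 1 [← Real.rpow_one (n : ℝ)]
      rw [← Real.rpow_add hn0]
      norm_num
    nlinarith [Real.rpow_nonneg hn0.le ((9 : ℝ) / 10)]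
  have h2k : 2 * k ≤ n := by
    have h : (n : ℝ) ^ (-(2 : ℝ) / 25) ≤ 1 :=
      Real.rpow_le_one_of_one_le_of_nonpos hn1.le (by norm_num)
    have : (2 : ℝ) * k ≤ n := by nlinarith
    exact_mod_cast this
  set x : ℝ := 1 / 25 * Real.log n / k with hx
  set d : ℝ := 1 / 50 * n * Real.log n / k with hd
  have hdx : 2 * d / n = x := by rw [hd, hx]; field_simp; norm_num
  have hx0 : 0 ≤ x := by positivity
  have hx1 : x ≤ 1 / 2 := by
    have h := Real.log_le_rpow_div hn0.le (by norm_num : (0 : ℝ) < 1 / 10)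
    rw [hx, div_le_iff₀ hk0]
    linarith
  have hA := half_le_card_low_degree E d (by positivity) (hE.trans_eq (by rw [hd]; ring))
  obtain ⟨S, T, -, hT, hST, hS⟩ := exists_large_common_nonneighborhood E
    {s : Fin n | (#{t | (s, t) ∈ E} : ℝ) ≤ d} d (fun s hs => (mem_filter.1 hs).2)
    (by rw [hdx]; linarith) k h2k
  rw [hdx] at hS
  have hpow : (n : ℝ) ^ (-(2 : ℝ) / 25) ≤ (1 - x) ^ k := by
    calc (n : ℝ) ^ (-(2 : ℝ) / 25) = Real.exp (-(2 * x)) ^ k := by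
          rw [← Real.exp_nat_mul, Real.rpow_def_of_pos hn0, hx]
          congr 1
          field_simp
      _ ≤ _ := by
          gcongr
          exact exp_neg_two_mul_le_one_sub hx0 hx1
  have hkc : k ≤ #S := by
    have : (k : ℝ) ≤ #S := hkS.trans (le_trans (by gcongr) hS)
    exact_mod_cast this
  obtain ⟨S', hS', hcard⟩ := exists_subset_card_eq hkc
  exact ⟨S', T, hcard, hT, fun s hs t ht => hST s (hS' hs) t ht⟩

/-- There exists `c > 0` such that for all sufficiently large `n`: if
`n^(1/10) ≤ k ≤ n^(9/10)` and the sequence of positive integers `(n_1, …, n_r)` is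
`(n, k)`-strong, then `∑ i, n_i² ≥ c · (n²/k) · log n`. -/
theorem stmt_3 :
    ∃ c : ℝ, c > 0 ∧ ∃ N : ℕ, ∀ n : ℕ, N ≤ n →
      ∀ k : ℕ, (n : ℝ) ^ ((1 : ℝ) / 10) ≤ (k : ℝ) → (k : ℝ) ≤ (n : ℝ) ^ ((9 : ℝ) / 10) →
      ∀ r : ℕ, ∀ ns : Fin r → ℕ, (∀ i, 0 < ns i) →
      IsStrong n k r ns →
        (∑ i, ((ns i : ℝ)) ^ 2) ≥ c * ((n : ℝ) ^ 2 / (k : ℝ)) * Real.log n := by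
  refine ⟨1 / 100, by norm_num, 2 ^ 50, fun n hn k hk hk' r ns _ ⟨V, W, hV, hW, hG⟩ => ?_⟩
  by_contra! hlt
  refine hG (hasBipIndepSet_of_card_le hn hk hk' _ (le_trans ?_ hlt.le))
  calc _ ≤ ((∑ i, (V i).card * (W i).card : ℕ) : ℝ) :=
        Nat.cast_le.2 (card_union_bicliques_le V W)
    _ = _ := by
        push_cast
        exact Finset.sum_congr rfl fun i _ => by rw [hV, hW, sq]
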